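/- arXiv:2303.16547 — 2 statements merged into one kernel-verified Lean document; each statement's English description precedes it below -/
import Mathlib

section
/- Let n ≥ 1, let 0 ≤ s ≤ n with n + s even, and let f : 𝔽₂ⁿ → 𝔽₂ be an s-plateaued function. Then the algebraic degree of f satisfies deg(f) ≤ (n − s)/2 + 1. -/
/-- Inner product on 𝔽₂ⁿ. -/
def ip {n : ℕ} (x y : Fin n → ZMod 2) : ZMod 2 := ∑ i, x i * y i

/-- Walsh–Hadamard transform of a Boolean function. -/
def walsh {n : ℕ} (f : (Fin n → ZMod 2) → ZMod 2) (y : Fin n → ZMod 2) : ℤ :=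
  ∑ x, (-1 : ℤ) ^ (f x + ip x y).val

/-- `f` is `s`-plateaued: all Walsh coefficients lie in `{0, ±2^((n+s)/2)}`. -/
def IsPlateaued {n : ℕ} (s : ℕ) (f : (Fin n → ZMod 2) → ZMod 2) : Prop :=
  ∀ y, walsh f y = 0 ∨ walsh f y = 2 ^ ((n + s) / 2) ∨ walsh f y = -2 ^ ((n + s) / 2)

/-- Hamming weight of a vector in 𝔽₂ⁿ. -/
def wt {n : ℕ} (y : Fin n → ZMod 2) : ℕ := ∑ i, (y i).val

/-- Möbius transform of a Boolean function. -/
def mobius {n : ℕ} (f : (Fin n → ZMod 2) → ZMod 2) (y : Fin n → ZMod 2) : ZMod 2 :=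
  ∑ x ∈ Finset.univ.filter (fun x : Fin n → ZMod 2 => ∀ i, x i * y i = x i), f x

/-- Algebraic degree of a Boolean function. -/
def degree {n : ℕ} (f : (Fin n → ZMod 2) → ZMod 2) : ℕ :=
  (Finset.univ.filter (fun y => mobius f y = 1)).sup wt

/-- The nontrivial character of `ZMod 2`, with values in `ℤ`, turns sums into products. -/
theorem neg_one_pow_val_add (a b : ZMod 2) :
    (-1 : ℤ) ^ (a + b).val = (-1) ^ a.val * (-1) ^ b.val := by
  revert a b; decide

theorem neg_one_pow_val_sum {ι : Type*} (s : Finset ι) (g : ι → ZMod 2) :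
    (-1 : ℤ) ^ (∑ i ∈ s, g i).val = ∏ i ∈ s, (-1 : ℤ) ^ (g i).val := by
  classical
  induction s using Finset.induction_on with
  | empty => simp
  | insert a s ha ih => rw [Finset.sum_insert ha, Finset.prod_insert ha, neg_one_pow_val_add, ih]

/-- There are `2 ^ wt y` vectors `x ≼ y`. -/
theorem card_below {n : ℕ} (y : Fin n → ZMod 2) :
    (Finset.univ.filter (fun x : Fin n → ZMod 2 => ∀ i, x i * y i = x i)).card = 2 ^ wt y := by
  have key : ∀ b : ZMod 2, (∑ a : ZMod 2, if a * b = a then 1 else 0) = 2 ^ b.val := by decide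
  rw [wt, ← Finset.prod_pow_eq_pow_sum, ← Finset.prod_congr rfl fun i _ => key (y i),
    Finset.prod_univ_sum, Fintype.piFinset_univ]
  simp [Finset.prod_ite_zero]

/-- Character sum over the vectors whose support is disjoint from that of `y`. -/
theorem sum_character_disjoint {n : ℕ} (x y : Fin n → ZMod 2) :
    (∑ u : Fin n → ZMod 2, if ∀ i, u i * y i = 0 then (-1 : ℤ) ^ (ip x u).val else 0) =
      if ∀ i, x i * y i = x i then 2 ^ (∑ i, (1 - (y i).val)) else 0 := by
  have key : ∀ a b : ZMod 2, (∑ c : ZMod 2, if c * b = 0 then (-1 : ℤ) ^ (a * c).val else 0) =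
      if a * b = a then 2 ^ (1 - b.val) else 0 := by decide
  have h := Finset.prod_congr (rfl : (Finset.univ : Finset (Fin n)) = Finset.univ)
    fun i _ => key (x i) (y i)
  rw [Finset.prod_univ_sum, Fintype.piFinset_univ] at h
  simpa [Finset.prod_ite_zero, Finset.prod_pow_eq_pow_sum, ip, neg_one_pow_val_sum] using h

theorem sum_one_sub_val {n : ℕ} (y : Fin n → ZMod 2) :
    wt y + ∑ i, (1 - (y i).val) = n := by
  have key : ∀ b : ZMod 2, b.val + (1 - b.val) = 1 := by decide
  simp [wt, ← Finset.sum_add_distrib, key]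

/-- Poisson summation over the coordinate subspace `{x | x ≼ y}`. -/
theorem sum_walsh_disjoint {n : ℕ} (f : (Fin n → ZMod 2) → ZMod 2) (y : Fin n → ZMod 2) :
    (∑ u : Fin n → ZMod 2, if ∀ i, u i * y i = 0 then walsh f u else 0) =
      2 ^ (∑ i, (1 - (y i).val)) *
        ∑ x ∈ Finset.univ.filter (fun x : Fin n → ZMod 2 => ∀ i, x i * y i = x i),
          (-1 : ℤ) ^ (f x).val := by
  calc _ = ∑ x, (-1 : ℤ) ^ (f x).val *
        ∑ u : Fin n → ZMod 2, if ∀ i, u i * y i = 0 then (-1 : ℤ) ^ (ip x u).val else 0 := by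
        simp only [Finset.mul_sum]
        rw [Finset.sum_comm]
        refine Finset.sum_congr rfl fun u _ => ?_
        split_ifs <;> simp [walsh, neg_one_pow_val_add]
    _ = _ := by
        simp only [sum_character_disjoint, Finset.mul_sum, Finset.sum_filter]
        refine Finset.sum_congr rfl fun x _ => ?_
        split_ifs <;> ring

/-- A restricted sum of `(-1) ^ f` is congruent to `2` modulo `4` when the Möbius transform
does not vanish. -/
theorem sum_below_eq_two_mul_odd {n : ℕ} (f : (Fin n → ZMod 2) → ZMod 2) (y : Fin n → ZMod 2)
    (hy : mobius f y = 1) (hw : 2 ≤ wt y) :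
    ∃ k : ℤ, Odd k ∧
      ∑ x ∈ Finset.univ.filter (fun x : Fin n → ZMod 2 => ∀ i, x i * y i = x i),
        (-1 : ℤ) ^ (f x).val = 2 * k := by
  have key : ∀ b : ZMod 2, (-1 : ℤ) ^ b.val = 1 - 2 * (b.val : ℤ) := by decide
  have hodd : Odd (∑ x ∈ Finset.univ.filter
      (fun x : Fin n → ZMod 2 => ∀ i, x i * y i = x i), (f x).val) := by
    rw [← ZMod.natCast_eq_one_iff_odd, Nat.cast_sum]
    simpa [mobius] using hy
  obtain ⟨m, hm⟩ := hodd
  obtain ⟨d, hd⟩ := Nat.exists_eq_add_of_le hw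
  refine ⟨2 * (2 ^ d - m) - 1, ⟨2 ^ d - m - 1, by ring⟩, ?_⟩
  simp only [key, Finset.sum_sub_distrib, ← Finset.mul_sum, ← Nat.cast_sum, hm]
  simp only [Finset.sum_const, card_below, hd, nsmul_eq_mul]
  push_cast
  ring

/-- The algebraic degree of an `n`-variable `s`-plateaued function is at most
`(n - s)/2 + 1`. -/
theorem plateaued_degree_le (n s : ℕ) (hn : 1 ≤ n) (hs : s ≤ n)
    (hpar : (n + s) % 2 = 0) (f : (Fin n → ZMod 2) → ZMod 2)
    (hf : IsPlateaued s f) : degree f ≤ (n - s) / 2 + 1 := by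
  refine Finset.sup_le fun y hy => ?_
  have hy1 : mobius f y = 1 := by simpa using hy
  by_cases hw : 2 ≤ wt y
  · obtain ⟨k, hk, hsum⟩ := sum_below_eq_two_mul_odd f y hy1 hw
    have hdvd : (2 : ℤ) ^ ((n + s) / 2) ∣
        ∑ u : Fin n → ZMod 2, if ∀ i, u i * y i = 0 then walsh f u else 0 := by
      refine Finset.dvd_sum fun u _ => ?_
      split_ifs
      · rcases hf u with h | h | h <;> simp [h]
      · exact dvd_zero _
    rw [sum_walsh_disjoint, hsum, ← mul_assoc, ← pow_succ] at hdvd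
    have hcop : IsCoprime ((2 : ℤ) ^ ((n + s) / 2)) k :=
      (Int.isCoprime_two_left.mpr hk).pow_left
    have hle := (pow_dvd_pow_iff (by norm_num) (by decide)).mp (hcop.dvd_of_dvd_mul_right hdvd)
    have := sum_one_sub_val y
    omega
  · omega
end

section
/- Let n ≥ 2, let 0 ≤ s ≤ n with n + s even, let f : 𝔽₂ⁿ → 𝔽₂ be an s-plateaued function, and fix x ∈ 𝔽₂ⁿ. Let V = (2ⁿ−1)(2ⁿ−2)/6 be the number of 2-dimensional affine subspaces of 𝔽₂ⁿ containing x, and let S(x) be the number of 2-dimensional affine subspaces containing x on which f takes the value 0 an odd number of times. Then S(x)/V = 1/2 − (2^{n+s} − 3·2ⁿ + 2)/(2(2ⁿ−1)(2ⁿ−2)); equivalently, (2ⁿ−1)(2ⁿ−2) − 12·S(x) = 2^{n+s} − 3·2ⁿ + 2. -/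
open scoped Classical

/-- `P` is a 2-dimensional affine subspace of 𝔽₂ⁿ: a set `{u, u⊕y, u⊕z, u⊕y⊕z}`
with `y, z, y⊕z` all nonzero and distinct (equivalently `y ≠ 0`, `z ≠ 0`, `y ≠ z`). -/
def IsAffinePlane {n : ℕ} (P : Finset (Fin n → ZMod 2)) : Prop :=
  ∃ u y z : Fin n → ZMod 2, y ≠ 0 ∧ z ≠ 0 ∧ y ≠ z ∧
    P = {u, u + y, u + z, u + y + z}

/-- The sign character `t ↦ (-1)^t` of `𝔽₂`. -/
def signChar (t : ZMod 2) : ℤ := (-1) ^ t.val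

theorem signChar_add (a b : ZMod 2) : signChar (a + b) = signChar a * signChar b := by
  revert a b
  decide

theorem signChar_mul_self (a : ZMod 2) : signChar a * signChar a = 1 := by
  revert a
  decide

theorem signChar_eq_one_sub (a : ZMod 2) : signChar a = 1 - 2 * (if a = 1 then 1 else 0) := by
  revert a
  decide

theorem add_self_eq_zero_of_zmod_two {n : ℕ} (v : Fin n → ZMod 2) : v + v = 0 := by
  funext i
  exact CharTwo.add_self_eq_zero (v i)

theorem add_eq_zero_iff_eq_of_zmod_two {n : ℕ} (v w : Fin n → ZMod 2) : v + w = 0 ↔ v = w := by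
  constructor
  · intro h
    have hw := add_self_eq_zero_of_zmod_two w
    exact add_right_cancel (h.trans hw.symm)
  · rintro rfl
    exact add_self_eq_zero_of_zmod_two v

theorem ip_add_left {n : ℕ} (a b y : Fin n → ZMod 2) : ip (a + b) y = ip a y + ip b y := by
  simp [ip, add_mul, Finset.sum_add_distrib]

theorem ip_add_right {n : ℕ} (v a b : Fin n → ZMod 2) : ip v (a + b) = ip v a + ip v b := by
  simp [ip, mul_add, Finset.sum_add_distrib]

/-- Orthogonality of the characters of `𝔽₂ⁿ`. -/
theorem sum_signChar_ip {n : ℕ} (v : Fin n → ZMod 2) :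
    ∑ y, signChar (ip v y) = if v = 0 then (2 : ℤ) ^ n else 0 := by
  split_ifs with hv
  · subst hv
    simp [ip, signChar]
  · obtain ⟨i, hi⟩ := Function.ne_iff.mp hv
    have hi1 : v i = 1 := by
      have : ∀ t : ZMod 2, t ≠ 0 → t = 1 := by decide
      exact this _ hi
    have hflip : ip v (Pi.single i 1) = 1 := by
      simp [ip, Pi.single_apply, hi1]
    have h := Equiv.sum_comp (Equiv.addRight (Pi.single i 1 : Fin n → ZMod 2))
      (fun y => signChar (ip v y))
    have hone : signChar 1 = -1 := by decide
    simp only [Equiv.coe_addRight, ip_add_right, signChar_add, hflip, hone, ← Finset.sum_mul] at h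
    linarith

theorem walsh_eq_sum {n : ℕ} (f : (Fin n → ZMod 2) → ZMod 2) (y : Fin n → ZMod 2) :
    walsh f y = ∑ a, signChar (f a) * signChar (ip a y) := by
  simp only [← signChar_add]
  rfl

/-- Fourier inversion for the Walsh transform. -/
theorem sum_walsh_mul_signChar {n : ℕ} (f : (Fin n → ZMod 2) → ZMod 2) (x : Fin n → ZMod 2) :
    ∑ y, walsh f y * signChar (ip x y) = 2 ^ n * signChar (f x) := by
  have h : ∀ y, walsh f y * signChar (ip x y) =
      ∑ a, signChar (f a) * signChar (ip (a + x) y) := by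
    intro y
    rw [walsh_eq_sum, Finset.sum_mul]
    refine Finset.sum_congr rfl fun a _ => ?_
    rw [ip_add_left, signChar_add]
    ring
  simp only [h]
  rw [Finset.sum_comm]
  simp only [← Finset.mul_sum, sum_signChar_ip, add_eq_zero_iff_eq_of_zmod_two]
  simp [mul_comm]

theorem sum_walsh_pow_three_mul_signChar {n : ℕ} (f : (Fin n → ZMod 2) → ZMod 2)
    (x : Fin n → ZMod 2) :
    ∑ y, walsh f y ^ 3 * signChar (ip x y) =
      2 ^ n * ∑ a, ∑ b, signChar (f a) * signChar (f b) * signChar (f (a + b + x)) := by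
  have h : ∀ y, walsh f y ^ 3 * signChar (ip x y) =
      ∑ a, ∑ b, signChar (f a) * signChar (f b) *
        (walsh f y * signChar (ip (a + b + x) y)) := by
    intro y
    have : walsh f y ^ 3 * signChar (ip x y) =
        (walsh f y * walsh f y) * (walsh f y * signChar (ip x y)) := by ring
    rw [this]
    nth_rewrite 1 2 [walsh_eq_sum]
    rw [Finset.sum_mul_sum, Finset.sum_mul]
    refine Finset.sum_congr rfl fun a _ => ?_
    rw [Finset.sum_mul]
    refine Finset.sum_congr rfl fun b _ => ?_
    rw [ip_add_left, ip_add_left, signChar_add, signChar_add]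
    ring
  simp only [h]
  rw [Finset.sum_comm, Finset.mul_sum]
  refine Finset.sum_congr rfl fun a _ => ?_
  rw [Finset.sum_comm, Finset.mul_sum]
  refine Finset.sum_congr rfl fun b _ => ?_
  rw [← Finset.mul_sum, sum_walsh_mul_signChar]
  ring

theorem IsPlateaued.walsh_pow_three {n s : ℕ} (hpar : (n + s) % 2 = 0)
    {f : (Fin n → ZMod 2) → ZMod 2} (hf : IsPlateaued s f) (y : Fin n → ZMod 2) :
    walsh f y ^ 3 = 2 ^ (n + s) * walsh f y := by
  have hpow : (2 : ℤ) ^ (n + s) = 2 ^ ((n + s) / 2) * 2 ^ ((n + s) / 2) := by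
    rw [← pow_add]
    congr 1
    omega
  rcases hf y with h | h | h <;> rw [h, hpow] <;> ring

/-- The fourth-order correlation of a plateaued function at a point. -/
theorem IsPlateaued.sum_signChar {n s : ℕ} (hpar : (n + s) % 2 = 0)
    {f : (Fin n → ZMod 2) → ZMod 2} (hf : IsPlateaued s f) (x : Fin n → ZMod 2) :
    ∑ a, ∑ b, signChar (f x + f a + f b + f (a + b + x)) = 2 ^ (n + s) := by
  have h := sum_walsh_pow_three_mul_signChar f x
  simp only [hf.walsh_pow_three hpar, mul_assoc (2 ^ (n + s) : ℤ)] at h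
  rw [← Finset.mul_sum, sum_walsh_mul_signChar] at h
  have hcorr : ∑ a, ∑ b, signChar (f a) * signChar (f b) * signChar (f (a + b + x)) =
      2 ^ (n + s) * signChar (f x) := by
    have hn : (2 : ℤ) ^ n ≠ 0 := by positivity
    apply mul_left_cancel₀ hn
    rw [← h]
    ring
  calc ∑ a, ∑ b, signChar (f x + f a + f b + f (a + b + x))
      = signChar (f x) *
          ∑ a, ∑ b, signChar (f a) * signChar (f b) * signChar (f (a + b + x)) := by
        simp only [signChar_add, Finset.mul_sum, mul_assoc]
    _ = 2 ^ (n + s) := by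
        rw [hcorr, mul_left_comm, signChar_mul_self, mul_one]

theorem mem_affine_quadruple_iff {n : ℕ} (u y z v : Fin n → ZMod 2) :
    v ∈ ({u, u + y, u + z, u + y + z} : Finset (Fin n → ZMod 2)) ↔
      ∃ i j : ZMod 2, v = u + i • y + j • z := by
  have h2 : ∀ p : ZMod 2 → Prop, (∃ i, p i) ↔ p 0 ∨ p 1 := fun p => Fin.exists_fin_two
  simp only [h2, Finset.mem_insert, Finset.mem_singleton, zero_smul, one_smul, add_zero]
  tauto

theorem IsAffinePlane.add_add_mem {n : ℕ} {P : Finset (Fin n → ZMod 2)} (hP : IsAffinePlane P)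
    {a b c : Fin n → ZMod 2} (ha : a ∈ P) (hb : b ∈ P) (hc : c ∈ P) : a + b + c ∈ P := by
  obtain ⟨u, y, z, -, -, -, rfl⟩ := hP
  rw [mem_affine_quadruple_iff] at *
  obtain ⟨i, j, rfl⟩ := ha
  obtain ⟨i', j', rfl⟩ := hb
  obtain ⟨i'', j'', rfl⟩ := hc
  refine ⟨i + i' + i'', j + j' + j'', ?_⟩
  simp only [add_smul]
  have hu := add_self_eq_zero_of_zmod_two u
  linear_combination hu

theorem card_affine_quadruple {n : ℕ} {x a b : Fin n → ZMod 2} (ha : a ≠ x) (hb : b ≠ x)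
    (hab : a ≠ b) : ({x, a, b, a + b + x} : Finset (Fin n → ZMod 2)).card = 4 := by
  have h1 : x ≠ a + b + x := by
    intro h
    apply hab
    rw [← add_eq_zero_iff_eq_of_zmod_two]
    exact (right_eq_add.mp h)
  have h2 : a ≠ a + b + x := by
    intro h
    apply hb
    rw [← add_eq_zero_iff_eq_of_zmod_two]
    exact left_eq_add.mp (h.trans (add_assoc a b x))
  have h3 : b ≠ a + b + x := by
    intro h
    apply ha
    rw [← add_eq_zero_iff_eq_of_zmod_two]
    exact left_eq_add.mp (h.trans (by abel : a + b + x = b + (a + x)))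
  simp [Finset.card_insert_of_notMem, ha.symm, hb.symm, hab, h1, h2, h3]

theorem IsAffinePlane.card_eq {n : ℕ} {P : Finset (Fin n → ZMod 2)} (hP : IsAffinePlane P) :
    P.card = 4 := by
  obtain ⟨u, y, z, hy, hz, hyz, rfl⟩ := hP
  have h := card_affine_quadruple (x := u) (a := u + y) (b := u + z)
    (by simpa using hy) (by simpa using hz) (by simpa using hyz)
  have hu := add_self_eq_zero_of_zmod_two u
  have he : u + y + (u + z) + u = u + y + z := by linear_combination hu
  rwa [he] at h

theorem isAffinePlane_quadruple {n : ℕ} {x a b : Fin n → ZMod 2} (ha : a ≠ x) (hb : b ≠ x)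
    (hab : a ≠ b) : IsAffinePlane {x, a, b, a + b + x} := by
  have hx := add_self_eq_zero_of_zmod_two x
  refine ⟨x, a + x, b + x, ?_, ?_, ?_, ?_⟩
  · rwa [Ne, add_eq_zero_iff_eq_of_zmod_two]
  · rwa [Ne, add_eq_zero_iff_eq_of_zmod_two]
  · simpa using hab
  · have h1 : x + (a + x) = a := by linear_combination hx
    have h2 : x + (b + x) = b := by linear_combination hx
    rw [h1, h2, add_assoc a b x]

/-- An affine plane is determined by three of its points. -/
theorem IsAffinePlane.eq_quadruple {n : ℕ} {P : Finset (Fin n → ZMod 2)} (hP : IsAffinePlane P)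
    {x a b : Fin n → ZMod 2} (hx : x ∈ P) (ha : a ∈ P) (hb : b ∈ P) (hax : a ≠ x) (hbx : b ≠ x)
    (hab : a ≠ b) : P = {x, a, b, a + b + x} := by
  symm
  apply Finset.eq_of_subset_of_card_le
  · have := hP.add_add_mem ha hb hx
    simp [Finset.insert_subset_iff, *]
  · rw [hP.card_eq, card_affine_quadruple hax hbx hab]

theorem card_filter_eq_zero_mod_two_iff {α : Type*} (f : α → ZMod 2) (P : Finset α) :
    (P.filter (fun v => f v = 0)).card % 2 = 1 ↔ (P.card : ZMod 2) + ∑ v ∈ P, f v = 1 := by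
  have h : ((P.filter (fun v => f v = 0)).card : ZMod 2) = P.card + ∑ v ∈ P, f v := by
    have h1 : ∀ t : ZMod 2, (if t = 0 then 1 else 0) = 1 + t := by decide
    rw [Finset.card_filter]
    push_cast
    rw [Finset.card_eq_sum_ones]
    push_cast
    rw [← Finset.sum_add_distrib]
    exact Finset.sum_congr rfl fun v _ => by convert h1 (f v)
  rw [← h, ← Nat.odd_iff, ZMod.natCast_eq_one_iff_odd]

theorem card_filter_quadruple_iff {n : ℕ} (f : (Fin n → ZMod 2) → ZMod 2)
    {x a b : Fin n → ZMod 2} (ha : a ≠ x) (hb : b ≠ x) (hab : a ≠ b) :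
    ((({x, a, b, a + b + x} : Finset (Fin n → ZMod 2)).filter (fun v => f v = 0)).card % 2 = 1) ↔
      f x + f a + f b + f (a + b + x) = 1 := by
  have hcard := card_affine_quadruple ha hb hab
  rw [card_filter_eq_zero_mod_two_iff, hcard]
  have h4 : ((4 : ℕ) : ZMod 2) = 0 := by decide
  rw [h4, zero_add]
  have h1 : x ∉ ({a, b, a + b + x} : Finset (Fin n → ZMod 2)) := by
    intro h
    rw [Finset.card_insert_of_mem h] at hcard
    have := Finset.card_le_three (a := a) (b := b) (c := a + b + x)
    omega
  have h2 : a ∉ ({b, a + b + x} : Finset (Fin n → ZMod 2)) := by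
    intro h
    rw [Finset.card_insert_of_notMem h1, Finset.card_insert_of_mem h] at hcard
    have := Finset.card_le_two (a := b) (b := a + b + x)
    omega
  have h3 : b ∉ ({a + b + x} : Finset (Fin n → ZMod 2)) := by
    intro h
    rw [Finset.card_insert_of_notMem h1, Finset.card_insert_of_notMem h2,
      Finset.card_insert_of_mem h] at hcard
    simp at hcard
  rw [Finset.sum_insert h1, Finset.sum_insert h2, Finset.sum_insert h3, Finset.sum_singleton]
  simp only [add_assoc]

theorem pairwise_ne_of_sum_eq_one {n : ℕ} {f : (Fin n → ZMod 2) → ZMod 2}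
    {x a b : Fin n → ZMod 2} (h : f x + f a + f b + f (a + b + x) = 1) :
    a ≠ x ∧ b ≠ x ∧ a ≠ b := by
  have key : ∀ s t : ZMod 2, s + s + t + t ≠ 1 ∧ s + t + s + t ≠ 1 ∧ s + t + t + s ≠ 1 := by
    decide
  refine ⟨?_, ?_, ?_⟩ <;> rintro rfl
  · have e : a + b + a = b := by
      linear_combination add_self_eq_zero_of_zmod_two a
    rw [e] at h
    exact (key _ _).1 h
  · have e : a + b + b = a := by
      linear_combination add_self_eq_zero_of_zmod_two b
    rw [e] at h
    exact (key _ _).2.1 h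
  · rw [add_self_eq_zero_of_zmod_two, zero_add] at h
    exact (key _ _).2.2 h

/-- Every odd plane through `x` arises from exactly six ordered pairs of further points. -/
theorem card_odd_pairs_eq {n : ℕ} (f : (Fin n → ZMod 2) → ZMod 2) (x : Fin n → ZMod 2) :
    ((Finset.univ : Finset ((Fin n → ZMod 2) × (Fin n → ZMod 2))).filter
        (fun p => f x + f p.1 + f p.2 + f (p.1 + p.2 + x) = 1)).card =
      ((Finset.univ : Finset (Finset (Fin n → ZMod 2))).filter
          (fun P => IsAffinePlane P ∧ x ∈ P ∧
            (P.filter (fun v => f v = 0)).card % 2 = 1)).card * 6 := by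
  rw [Finset.card_eq_sum_card_fiberwise
    (f := fun p => ({x, p.1, p.2, p.1 + p.2 + x} : Finset (Fin n → ZMod 2)))
    (t := (Finset.univ : Finset (Finset (Fin n → ZMod 2))).filter
      (fun P => IsAffinePlane P ∧ x ∈ P ∧ (P.filter (fun v => f v = 0)).card % 2 = 1))]
  · apply Finset.sum_const_nat
    intro P hP
    obtain ⟨hplane, hx, hodd⟩ := (Finset.mem_filter.mp hP).2
    have hfib : (Finset.univ.filter
          (fun p : (Fin n → ZMod 2) × (Fin n → ZMod 2) =>
            f x + f p.1 + f p.2 + f (p.1 + p.2 + x) = 1)).filter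
          (fun p => ({x, p.1, p.2, p.1 + p.2 + x} : Finset (Fin n → ZMod 2)) = P) =
        (P.erase x).offDiag := by
      ext ⟨a, b⟩
      simp only [Finset.mem_filter, Finset.mem_univ, true_and, Finset.mem_offDiag,
        Finset.mem_erase]
      constructor
      · rintro ⟨h, rfl⟩
        obtain ⟨h1, h2, h3⟩ := pairwise_ne_of_sum_eq_one h
        exact ⟨⟨h1, by simp⟩, ⟨h2, by simp⟩, h3⟩
      · rintro ⟨⟨h1, ha⟩, ⟨h2, hb⟩, h3⟩
        have he := hplane.eq_quadruple hx ha hb h1 h2 h3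
        rw [he, card_filter_quadruple_iff f h1 h2 h3] at hodd
        exact ⟨hodd, he.symm⟩
    rw [hfib, Finset.offDiag_card, Finset.card_erase_of_mem hx, hplane.card_eq]
  · rintro ⟨a, b⟩ h
    have h : f x + f a + f b + f (a + b + x) = 1 := by simpa using h
    obtain ⟨h1, h2, h3⟩ := pairwise_ne_of_sum_eq_one h
    simp only [Finset.coe_filter, Finset.mem_univ, true_and, Set.mem_ofPred_eq]
    exact ⟨isAffinePlane_quadruple h1 h2 h3, by simp, (card_filter_quadruple_iff f h1 h2 h3).2 h⟩

/-- For an `s`-plateaued function `f` and a fixed point `x`, if `S(x)` is the number of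
2-dimensional affine subspaces containing `x` on which `f` vanishes an odd number of
times, then `(2ⁿ-1)(2ⁿ-2) - 12·S(x) = 2^{n+s} - 3·2ⁿ + 2`; equivalently
`S(x)/V = 1/2 - (2^{n+s} - 3·2ⁿ + 2)/(2(2ⁿ-1)(2ⁿ-2))` with `V = (2ⁿ-1)(2ⁿ-2)/6`. -/
theorem plateaued_odd_plane_count (n s : ℕ) (hn : 2 ≤ n) (hs : s ≤ n)
    (hpar : (n + s) % 2 = 0) (f : (Fin n → ZMod 2) → ZMod 2)
    (hf : IsPlateaued s f) (x : Fin n → ZMod 2) :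
    ((2 ^ n - 1) * (2 ^ n - 2) : ℤ) -
        12 * ((Finset.univ : Finset (Finset (Fin n → ZMod 2))).filter
          (fun P => IsAffinePlane P ∧ x ∈ P ∧
            (P.filter (fun v => f v = 0)).card % 2 = 1)).card
      = 2 ^ (n + s) - 3 * 2 ^ n + 2 := by
  have hT := hf.sum_signChar hpar x
  rw [← Fintype.sum_prod_type'
    (f := fun a b => signChar (f x + f a + f b + f (a + b + x)))] at hT
  simp only [signChar_eq_one_sub, Finset.sum_sub_distrib, ← Finset.mul_sum,
    Finset.sum_boole] at hT
  rw [card_odd_pairs_eq f x] at hT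
  simp only [Finset.sum_const, Finset.card_univ, Fintype.card_prod, Fintype.card_fun, ZMod.card,
    Fintype.card_fin] at hT
  push_cast at hT
  simp only [nsmul_eq_mul] at hT
  push_cast at hT
  linarith
end
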